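/- arXiv:2411.19394 — 2 statements merged into one kernel-verified Lean document; each statement's English description precedes it below -/
import Mathlib

section
/- Let Σ be a finite alphabet and c ≥ 1. Let A_1, A_2, …, A_{2t} ⊆ Σ^c be sets of keys and let p ⊆ [c] × Σ be a generalized key (a set of position–character pairs). Then the number of 2t-tuples (x_1, …, x_{2t}) ∈ A_1 × ⋯ × A_{2t} whose symmetric difference (as sets of position characters) equals p is at most ((2t-1)!!)^c · ∏_{k=1}^{2t} √|A_k|. -/
open Finset

/-- The symmetric difference of a tuple of keys, viewed as sets of position characters:
the set of pairs `(i, a)` such that `a` occurs an odd number of times at position `i`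
among the keys of the tuple. -/
def oddSupport {k c : ℕ} {A : Type*} [Fintype A] [DecidableEq A]
    (x : Fin k → (Fin c → A)) : Finset (Fin c × A) :=
  Finset.univ.filter
    (fun pc => Odd ((Finset.univ.filter (fun j : Fin k => x j pc.1 = pc.2)).card))

/-- The parity vector of a tuple of characters: the value at `a` is the number of occurrences
of `a`, modulo two. -/
def parityVector {n : ℕ} {S : Type*} [DecidableEq S] (y : Fin n → S) : S → ZMod 2 :=
  ∑ k, Pi.single (y k) 1

lemma parityVector_apply {n : ℕ} {S : Type*} [DecidableEq S] (y : Fin n → S) (a : S) :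
    parityVector y a = ((univ.filter (fun k => y k = a)).card : ZMod 2) := by
  simp [parityVector, Finset.sum_apply, Pi.single_apply, eq_comm]

lemma parityVector_cons {n : ℕ} {S : Type*} [DecidableEq S] (a : S) (w : Fin n → S) :
    parityVector (Fin.cons a w : Fin (n + 1) → S) = Pi.single a 1 + parityVector w := by
  simp [parityVector, Fin.sum_univ_succ]

lemma parityVector_insertNth {n : ℕ} {S : Type*} [DecidableEq S] (j : Fin (n + 1)) (b : S)
    (z : Fin n → S) :
    parityVector (j.insertNth b z : Fin (n + 1) → S) = Pi.single b 1 + parityVector z := by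
  simp [parityVector, Fin.sum_univ_succAbove _ j]

lemma sum_parityVector {n : ℕ} {S : Type*} [Fintype S] [DecidableEq S] (y : Fin n → S) :
    ∑ a, parityVector y a = n := by
  simp only [parityVector, Finset.sum_apply]
  rw [Finset.sum_comm]
  simp

lemma exists_eq_of_parityVector_ne_zero {n : ℕ} {S : Type*} [DecidableEq S] {y : Fin n → S}
    {a : S} (h : parityVector y a ≠ 0) : ∃ k, y k = a := by
  by_contra! hy
  exact h (by simp [parityVector_apply, hy])

/-- If the entries of `q` sum to zero, there is a permutation sending every `a` to a point at which
`q - Pi.single a 1` does not vanish. -/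
lemma exists_perm_sub_single_ne_zero {S : Type*} [Fintype S] [DecidableEq S] (q : S → ZMod 2)
    (hq : ∑ a, q a = 0) :
    ∃ τ : Equiv.Perm S, ∀ a, (q - Pi.single a 1 : S → ZMod 2) (τ a) ≠ 0 := by
  set l := (univ.filter (fun a => q a ≠ 0)).toList with hl
  have hnd : l.Nodup := Finset.nodup_toList _
  have hmem : ∀ a, a ∈ l ↔ q a ≠ 0 := by simp [hl]
  refine ⟨l.formPerm, fun a => ?_⟩
  by_cases ha : q a = 0
  · rw [List.formPerm_apply_of_notMem (by simp [hmem, ha])]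
    simp [ha]
  · have hal : a ∈ l := (hmem a).2 ha
    have hne : l.formPerm a ≠ a := by
      intro h
      rw [List.formPerm_apply_mem_eq_self_iff l hnd a hal] at h
      have huniq : ∀ b, b ≠ a → q b = 0 := by
        intro b hb
        by_contra hqb
        have hcard : 1 < (univ.filter (fun a => q a ≠ 0)).card :=
          Finset.one_lt_card.2 ⟨a, by simpa using ha, b, by simpa using hqb, hb.symm⟩
        rw [hl, Finset.length_toList] at h
        omega
      rw [Fintype.sum_eq_single a huniq] at hq
      exact ha hq
    have := (hmem _).1 (List.formPerm_apply_mem_of_mem hal)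
    simpa [Pi.single_apply, hne] using this

lemma sum_mul_perm_le_sqrt_mul_sqrt {S : Type*} [Fintype S] (f g : S → ℝ) (τ : Equiv.Perm S) :
    ∑ a, f a * g (τ a) ≤ √(∑ a, f a ^ 2) * √(∑ a, g a ^ 2) := by
  rw [← Equiv.sum_comp τ (fun a => g a ^ 2)]
  exact Real.sum_mul_le_sqrt_mul_sqrt _ _ _

lemma doubleFactorial_two_mul_succ_sub_one (t : ℕ) :
    Nat.doubleFactorial (2 * (t + 1) - 1) = (2 * t + 1) * Nat.doubleFactorial (2 * t - 1) := by
  cases t with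
  | zero => rfl
  | succ t => exact Nat.doubleFactorial_add_two (2 * t + 1)

/-- The weighted count of tuples of characters with prescribed parity vector. -/
lemma sum_prod_parityVector_le {S : Type*} [Fintype S] [DecidableEq S] (t : ℕ)
    (g : Fin (2 * t) → S → ℝ) (hg : ∀ k a, 0 ≤ g k a) (q : S → ZMod 2) :
    ∑ y : Fin (2 * t) → S, (if parityVector y = q then ∏ k, g k (y k) else 0) ≤
      (Nat.doubleFactorial (2 * t - 1) : ℝ) * ∏ k, √(∑ a, g k a ^ 2) := by
  induction t generalizing q with
  | zero =>
    simp only [Nat.mul_zero, Finset.univ_eq_empty, Finset.prod_empty]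
    rw [Fintype.sum_unique]
    split_ifs <;> simp
  | succ t ih =>
    by_cases hq : ∑ a, q a = 0
    swap
    · rw [Finset.sum_eq_zero]
      · positivity
      · intro y _
        rw [if_neg]
        rintro rfl
        refine hq ?_
        rw [sum_parityVector]
        push_cast
        rw [show (2 : ZMod 2) = 0 from rfl, zero_mul]
    obtain ⟨τ, hτ⟩ := exists_perm_sub_single_ne_zero q hq
    let r : S → S → ZMod 2 := fun a => q - Pi.single a 1 - Pi.single (τ a) 1
    let g' : Fin (2 * t + 1) → S → ℝ := fun k => g k.succ
    have hg' : ∀ k a, 0 ≤ g' k a := fun k a => hg _ _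
    let N : Fin (2 * t + 2) → ℝ := fun k => √(∑ a, g k a ^ 2)
    have hN : ∀ k, 0 ≤ N k := fun k => Real.sqrt_nonneg _
    let D : ℝ := (Nat.doubleFactorial (2 * t - 1) : ℝ)
    have hD : 0 ≤ D := Nat.cast_nonneg _
    calc ∑ y : Fin (2 * t + 2) → S, (if parityVector y = q then ∏ k, g k (y k) else 0)
        = ∑ a, ∑ w : Fin (2 * t + 1) → S, (if Pi.single a 1 + parityVector w = q then
            g 0 a * ∏ k, g' k (w k) else 0) := by
          rw [← Equiv.sum_comp (Fin.consEquiv (fun _ : Fin (2 * t + 2) => S)),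
            Fintype.sum_prod_type]
          refine Finset.sum_congr rfl fun a _ => Finset.sum_congr rfl fun w _ => ?_
          have hprod : ∏ k, g k ((Fin.cons a w : Fin (2 * t + 2) → S) k) =
              g 0 a * ∏ k, g' k (w k) := Fin.prod_univ_succ _
          simp [Fin.consEquiv, parityVector_cons, hprod]
      _ ≤ ∑ a, ∑ w : Fin (2 * t + 1) → S, ∑ j : Fin (2 * t + 1),
            (if w j = τ a ∧ Pi.single a 1 + parityVector w = q then
              g 0 a * ∏ k, g' k (w k) else 0) := by
          refine Finset.sum_le_sum fun a _ => Finset.sum_le_sum fun w _ => ?_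
          have hF : 0 ≤ g 0 a * ∏ k, g' k (w k) :=
            mul_nonneg (hg _ _) (Finset.prod_nonneg fun k _ => hg' _ _)
          have hnn : ∀ j ∈ (univ : Finset (Fin (2 * t + 1))),
              0 ≤ (if w j = τ a ∧ Pi.single a 1 + parityVector w = q then
                g 0 a * ∏ k, g' k (w k) else 0) := by
            intro j _
            split_ifs <;> first | exact hF | exact le_rfl
          split_ifs with h
          · have hw : parityVector w = q - Pi.single a 1 := by rw [← h]; abel
            obtain ⟨j, hj⟩ := exists_eq_of_parityVector_ne_zero (y := w) (a := τ a)
              (by rw [hw]; exact hτ a)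
            refine le_trans ?_ (Finset.single_le_sum hnn (Finset.mem_univ j))
            rw [if_pos ⟨hj, h⟩]
          · exact Finset.sum_nonneg (by simp [h])
      _ = ∑ j : Fin (2 * t + 1), ∑ a, ∑ w : Fin (2 * t + 1) → S,
            (if w j = τ a ∧ Pi.single a 1 + parityVector w = q then
              g 0 a * ∏ k, g' k (w k) else 0) := by
          exact (Finset.sum_congr rfl fun a _ => Finset.sum_comm).trans Finset.sum_comm
      _ = ∑ j : Fin (2 * t + 1), ∑ a, g 0 a * g' j (τ a) *
            ∑ z : Fin (2 * t) → S,
              (if parityVector z = r a then ∏ k, g' (j.succAbove k) (z k) else 0) := by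
          refine Finset.sum_congr rfl fun j _ => Finset.sum_congr rfl fun a _ => ?_
          rw [← Equiv.sum_comp (Fin.insertNthEquiv (fun _ : Fin (2 * t + 1) => S) j),
            Fintype.sum_prod_type, Fintype.sum_eq_single (τ a), Finset.mul_sum]
          · refine Finset.sum_congr rfl fun z _ => ?_
            have hiff : Pi.single a 1 + (Pi.single (τ a) 1 + parityVector z) = q ↔
                parityVector z = r a := by
              simp only [r]
              constructor
              · intro h; rw [← h]; abel
              · intro h; rw [h]; abel
            simp [Fin.insertNthEquiv, parityVector_insertNth, hiff,
              Fin.prod_univ_succAbove _ j, mul_assoc]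
          · intro b hb
            simp [Fin.insertNthEquiv, hb]
      _ ≤ ∑ j : Fin (2 * t + 1), ∑ a, g 0 a * g' j (τ a) *
            (D * ∏ k, N (j.succAbove k).succ) := by
          refine Finset.sum_le_sum fun j _ => Finset.sum_le_sum fun a _ => ?_
          exact mul_le_mul_of_nonneg_left
            (ih (fun k => g' (j.succAbove k)) (fun k a => hg' _ _) (r a))
            (mul_nonneg (hg _ _) (hg' _ _))
      _ ≤ ∑ j : Fin (2 * t + 1), D * ∏ k, N k := by
          refine Finset.sum_le_sum fun j _ => ?_
          rw [← Finset.sum_mul, Fin.prod_univ_succ, Fin.prod_univ_succAbove _ j]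
          have h := sum_mul_perm_le_sqrt_mul_sqrt (g 0) (g' j) τ
          calc _ ≤ N 0 * N j.succ * (D * ∏ k, N (j.succAbove k).succ) :=
                mul_le_mul_of_nonneg_right h
                  (mul_nonneg hD (Finset.prod_nonneg fun k _ => hN _))
            _ = _ := by ring
      _ = _ := by
          rw [doubleFactorial_two_mul_succ_sub_one, Finset.sum_const]
          simp only [Finset.card_univ, Fintype.card_fin, nsmul_eq_mul, Nat.cast_mul, D, mul_assoc]
          rfl

/-- The weighted count of tuples of keys whose parity vector is prescribed at every position. -/
lemma sum_prod_forall_parityVector_le {S : Type*} [Fintype S] [DecidableEq S] (c t : ℕ)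
    (f : Fin (2 * t) → (Fin c → S) → ℝ) (hf : ∀ k a, 0 ≤ f k a) (q : Fin c → S → ZMod 2) :
    ∑ x : Fin (2 * t) → Fin c → S,
        (if ∀ i, parityVector (fun k => x k i) = q i then ∏ k, f k (x k) else 0) ≤
      (Nat.doubleFactorial (2 * t - 1) : ℝ) ^ c * ∏ k, √(∑ a, f k a ^ 2) := by
  induction c with
  | zero =>
    rw [Fintype.sum_unique]
    simp only [IsEmpty.forall_iff, if_true, pow_zero, one_mul]
    refine Finset.prod_le_prod (fun k _ => hf _ _) fun k _ => ?_
    rw [Fintype.sum_unique, Real.sqrt_sq (hf _ _)]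
    exact le_of_eq (congrArg _ (Subsingleton.elim _ _))
  | succ c ih =>
    let e : (Fin (2 * t) → S) × (Fin (2 * t) → Fin c → S) ≃ (Fin (2 * t) → Fin (c + 1) → S) :=
      (Equiv.arrowProdEquivProdArrow _ (fun _ => S) (fun _ => Fin c → S)).symm.trans
        (Equiv.piCongrRight fun _ => Fin.consEquiv (fun _ : Fin (c + 1) => S))
    have he : ∀ y z k, e (y, z) k = Fin.cons (y k) (z k) := fun y z k => rfl
    let D : ℝ := (Nat.doubleFactorial (2 * t - 1) : ℝ)
    have hD : 0 ≤ D := Nat.cast_nonneg _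
    let g : Fin (2 * t) → S → ℝ := fun k a => √(∑ b : Fin c → S, f k (Fin.cons a b) ^ 2)
    calc ∑ x : Fin (2 * t) → Fin (c + 1) → S,
        (if ∀ i, parityVector (fun k => x k i) = q i then ∏ k, f k (x k) else 0)
        = ∑ y : Fin (2 * t) → S, if parityVector y = q 0 then
            ∑ z : Fin (2 * t) → Fin c → S,
              (if ∀ i, parityVector (fun k => z k i) = q (Fin.succ i) then
                ∏ k, f k (Fin.cons (y k) (z k)) else 0) else 0 := by
          rw [← Equiv.sum_comp e, Fintype.sum_prod_type]
          refine Finset.sum_congr rfl fun y _ => ?_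
          simp only [Fin.forall_fin_succ, he, Fin.cons_zero, Fin.cons_succ]
          split_ifs with h <;> simp [h]
      _ ≤ ∑ y : Fin (2 * t) → S, D ^ c *
            (if parityVector y = q 0 then ∏ k, g k (y k) else 0) := by
          refine Finset.sum_le_sum fun y _ => ?_
          split_ifs with h
          · exact ih (fun k b => f k (Fin.cons (y k) b)) (fun _ _ => hf _ _) _
          · simp
      _ ≤ D ^ c * (D * ∏ k, √(∑ a, g k a ^ 2)) := by
          rw [← Finset.mul_sum]
          exact mul_le_mul_of_nonneg_left
            (sum_prod_parityVector_le t g (fun _ _ => Real.sqrt_nonneg _) (q 0))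
            (pow_nonneg hD c)
      _ = _ := by
          rw [← mul_assoc, ← pow_succ]
          congr 1
          refine Finset.prod_congr rfl fun k _ => ?_
          congr 1
          rw [← Equiv.sum_comp (Fin.consEquiv (fun _ : Fin (c + 1) => S)),
            Fintype.sum_prod_type]
          refine Finset.sum_congr rfl fun a _ => ?_
          exact Real.sq_sqrt (Finset.sum_nonneg fun _ _ => sq_nonneg _)

lemma parityVector_eq_of_oddSupport_eq {n c : ℕ} {S : Type*} [Fintype S] [DecidableEq S]
    {x : Fin n → Fin c → S} {p : Finset (Fin c × S)} (h : oddSupport x = p) (i : Fin c) :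
    parityVector (fun k => x k i) = fun a => if (i, a) ∈ p then 1 else 0 := by
  funext a
  rw [parityVector_apply, ← h]
  simp only [oddSupport, Finset.mem_filter, Finset.mem_univ, true_and]
  split_ifs with ho
  · exact ZMod.natCast_eq_one_iff_odd.2 ho
  · exact ZMod.natCast_eq_zero_iff_even.2 (Nat.not_odd_iff_even.1 ho)

/-- Counting tuples with a prescribed symmetric difference: the number of `2t`-tuples
`(x₁, …, x_{2t}) ∈ A₁ × ⋯ × A_{2t}` whose symmetric difference of position characters
equals `p` is at most `((2t-1)‼)^c · ∏ √|A_k|`. -/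
theorem stmt6 {Alph : Type*} [Fintype Alph] [DecidableEq Alph] (c t : ℕ) (hc : 1 ≤ c)
    (A : Fin (2 * t) → Finset (Fin c → Alph)) (p : Finset (Fin c × Alph)) :
    ((Finset.univ.filter (fun x : Fin (2 * t) → (Fin c → Alph) =>
        (∀ k, x k ∈ A k) ∧ oddSupport x = p)).card : ℝ) ≤
      (Nat.doubleFactorial (2 * t - 1) : ℝ) ^ c * ∏ k, Real.sqrt ((A k).card) := by
  have key := sum_prod_forall_parityVector_le c t
    (fun k a => if a ∈ A k then (1 : ℝ) else 0) (fun k a => by positivity)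
    (fun i a => if (i, a) ∈ p then 1 else 0)
  have hsq : ∀ k, ∑ a, (if a ∈ A k then (1 : ℝ) else 0) ^ 2 = (A k).card := by
    intro k
    simp [ite_pow]
  simp only [hsq] at key
  refine le_trans ?_ key
  rw [Finset.card_filter, Nat.cast_sum]
  refine Finset.sum_le_sum fun x _ => ?_
  by_cases h : (∀ k, x k ∈ A k) ∧ oddSupport x = p
  · rw [if_pos h, if_pos (parityVector_eq_of_oddSupport_eq h.2)]
    simp [h.1]
  · rw [if_neg h, Nat.cast_zero]
    split_ifs
    · exact Finset.prod_nonneg fun k _ => by positivity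
    · exact le_rfl
end

section
/- Let S ⊆ Σ^c be a set of n keys and p a generalized key. Then the number of 2t-tuples (x_1,…,x_{2t}) ∈ S^{2t} with symmetric difference Δ_{i∈[2t]} x_i = p is at most ((2t-1)!!)^c · n^t. -/
open Finset

/-- Odd-degree differences are bounded by the trapezoid rule. -/
lemma sub_mul_pow_sub_pow_le (t : ℕ) (u v : ℝ) :
    2 * ((u - v) * (u ^ (2 * t + 1) - v ^ (2 * t + 1))) ≤
      (2 * t + 1) * ((u - v) ^ 2 * (u ^ (2 * t) + v ^ (2 * t))) := by
  have pair (i j : ℕ) (h : Even (i + j)) :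
      u ^ i * v ^ j + u ^ j * v ^ i ≤ u ^ (i + j) + v ^ (i + j) := by
    suffices 0 ≤ (u ^ i - v ^ i) * (u ^ j - v ^ j) by
      rw [pow_add, pow_add]; linarith
    rcases Nat.even_or_odd i with hi | hi
    · have hj : Even j := (Nat.even_add.mp h).mp hi
      obtain ⟨a, rfl⟩ := even_iff_two_dvd.mp hi
      obtain ⟨b, rfl⟩ := even_iff_two_dvd.mp hj
      simp only [pow_mul]
      rcases le_total (u ^ 2) (v ^ 2) with h | h
      · exact mul_nonneg_of_nonpos_of_nonpos
          (sub_nonpos.2 (pow_le_pow_left₀ (sq_nonneg u) h a))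
          (sub_nonpos.2 (pow_le_pow_left₀ (sq_nonneg u) h b))
      · exact mul_nonneg
          (sub_nonneg.2 (pow_le_pow_left₀ (sq_nonneg v) h a))
          (sub_nonneg.2 (pow_le_pow_left₀ (sq_nonneg v) h b))
    · have hj : Odd j := by grind
      rcases le_total u v with h | h
      · exact mul_nonneg_of_nonpos_of_nonpos
          (sub_nonpos.2 (hi.strictMono_pow.monotone h)) (sub_nonpos.2 (hj.strictMono_pow.monotone h))
      · exact mul_nonneg
          (sub_nonneg.2 (hi.strictMono_pow.monotone h)) (sub_nonneg.2 (hj.strictMono_pow.monotone h))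
  have key : 2 * ∑ i ∈ range (2 * t + 1), u ^ i * v ^ (2 * t + 1 - 1 - i) ≤
      (2 * t + 1) * (u ^ (2 * t) + v ^ (2 * t)) := by
    rw [two_mul (∑ i ∈ _, _)]
    nth_rw 2 [← sum_range_reflect]
    rw [← sum_add_distrib]
    refine (sum_le_card_nsmul _ _ (u ^ (2 * t) + v ^ (2 * t)) fun i hi ↦ ?_).trans_eq ?_
    · have hi' : i ≤ 2 * t := by have := mem_range.1 hi; omega
      have := pair i (2 * t - i) (by simp [Nat.add_sub_cancel' hi'])
      rw [Nat.add_sub_cancel' hi'] at this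
      simpa [Nat.sub_sub_self hi'] using this
    · simp [mul_add]
  rw [← (Commute.all u v).geom_sum₂_mul]
  have := mul_le_mul_of_nonneg_left key (sq_nonneg (u - v))
  linarith

/-- **Khintchine's inequality** for even moments, with the Gaussian constant. -/
lemma sum_sign_pow_le {A : Type*} [Fintype A] [DecidableEq A] (g : A → ℝ) (t : ℕ) :
    ∑ ε : A → ℤˣ, (∑ a, (ε a : ℤ) * g a) ^ (2 * t) ≤
      Fintype.card (A → ℤˣ) * (Nat.doubleFactorial (2 * t - 1)) * (∑ a, g a ^ 2) ^ t := by
  induction t with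
  | zero => simp
  | succ t ih =>
    set X : (A → ℤˣ) → ℝ := fun ε ↦ ∑ a, (ε a : ℤ) * g a with hX
    have step (a : A) : ∑ ε, ((ε a : ℤ) * g a) * X ε ^ (2 * t + 1) ≤
        (2 * t + 1) * g a ^ 2 * ∑ ε, X ε ^ (2 * t) := by
      let flip : (A → ℤˣ) ≃ (A → ℤˣ) := Equiv.mulRight (Pi.mulSingle a (-1))
      have flip_self (ε : A → ℤˣ) : flip ε a = -ε a := by simp [flip]
      have flip_X (ε : A → ℤˣ) : X (flip ε) = X ε - 2 * ((ε a : ℤ) * g a) := by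
        simp only [hX]
        rw [← add_sum_erase _ _ (mem_univ a),
          ← add_sum_erase univ (fun b ↦ ((ε b : ℤ) : ℝ) * g b) (mem_univ a), flip_self, sum_congr rfl (g := fun b ↦ ((ε b : ℤ) : ℝ) * g b)]
        · push_cast; ring
        · intro b hb
          simp [flip, Pi.mulSingle_eq_of_ne (ne_of_mem_erase hb)]
      have e1 := Equiv.sum_comp flip fun ε ↦ ((ε a : ℤ) * g a) * X ε ^ (2 * t + 1)
      have e2 := Equiv.sum_comp flip fun ε ↦ X ε ^ (2 * t)
      suffices ∑ ε, ((ε a : ℤ) * g a) * X ε ^ (2 * t + 1) +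
          ∑ ε, ((flip ε a : ℤ) * g a) * X (flip ε) ^ (2 * t + 1) ≤
          (2 * t + 1) * g a ^ 2 * (∑ ε, X ε ^ (2 * t) + ∑ ε, X (flip ε) ^ (2 * t)) by
        rw [e1, e2] at this; linarith
      rw [← sum_add_distrib, ← sum_add_distrib, mul_sum]
      refine sum_le_sum fun ε _ ↦ ?_
      have h := sub_mul_pow_sub_pow_le t (X ε) (X (flip ε))
      have hs : (((ε a : ℤ) : ℝ) * g a) ^ 2 = g a ^ 2 := by
        rcases Int.units_eq_one_or (ε a) with h | h <;> simp [h]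
      have hd : X ε - X (flip ε) = 2 * ((ε a : ℤ) * g a) := by rw [flip_X]; ring
      rw [hd, mul_pow, hs] at h
      rw [flip_self]
      push_cast
      linarith
    have hdf : Nat.doubleFactorial (2 * (t + 1) - 1) =
        (2 * t + 1) * Nat.doubleFactorial (2 * t - 1) := by
      rcases t with _ | t
      · rfl
      · exact Nat.doubleFactorial_add_two (2 * t + 1)
    calc ∑ ε, X ε ^ (2 * (t + 1))
        = ∑ a, ∑ ε, ((ε a : ℤ) * g a) * X ε ^ (2 * t + 1) := by
          rw [sum_comm]
          refine sum_congr rfl fun ε _ ↦ ?_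
          rw [← sum_mul]
          exact pow_succ' _ _
      _ ≤ ∑ a, (2 * t + 1) * g a ^ 2 * ∑ ε, X ε ^ (2 * t) := sum_le_sum fun a _ ↦ step a
      _ = (2 * t + 1) * (∑ a, g a ^ 2) * ∑ ε, X ε ^ (2 * t) := by rw [← sum_mul, ← mul_sum]
      _ ≤ (2 * t + 1) * (∑ a, g a ^ 2) * (Fintype.card (A → ℤˣ) *
            (Nat.doubleFactorial (2 * t - 1)) * (∑ a, g a ^ 2) ^ t) := by gcongr
      _ = _ := by rw [hdf]; push_cast; ring

/-- A form of Minkowski's inequality for integer exponents. -/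
lemma sum_sum_pow_le {Ω A : Type*} [Fintype Ω] [Fintype A] {t : ℕ} (ht : t ≠ 0) {K : ℝ}
    (h : Ω → A → ℝ) (hh : ∀ ω a, 0 ≤ h ω a) (s : A → ℝ) (hs : ∀ a, 0 ≤ s a)
    (hK : ∀ a, ∑ ω, h ω a ^ t ≤ K * s a ^ t) :
    ∑ ω, (∑ a, h ω a) ^ t ≤ K * (∑ a, s a) ^ t := by
  have zero (a : A) (ha : s a = 0) (ω : Ω) : h ω a = 0 := by
    have h1 : h ω a ^ t ≤ 0 :=
      (single_le_sum (f := fun ω ↦ h ω a ^ t) (fun ω _ ↦ pow_nonneg (hh ω a) t)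
        (mem_univ ω)).trans ((hK a).trans_eq (by simp [ha, ht]))
    exact eq_zero_of_pow_eq_zero (h1.antisymm (pow_nonneg (hh ω a) t))
  rcases (sum_nonneg fun a _ ↦ hs a).eq_or_lt with h0 | hpos
  · have : ∀ a, s a = 0 := fun a ↦
      (sum_eq_zero_iff_of_nonneg fun a _ ↦ hs a).1 h0.symm a (mem_univ a)
    simp [this, zero, ht]
  set T := ∑ a, s a with hT
  have jensen (ω : Ω) : (∑ a, h ω a) ^ t ≤ T ^ t * ∑ a, s a / T * (h ω a / s a) ^ t := by
    have := Real.pow_arith_mean_le_arith_mean_pow univ (fun a ↦ s a / T) (fun a ↦ h ω a / s a)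
      (fun a _ ↦ div_nonneg (hs a) hpos.le) (by rw [← sum_div]; exact div_self hpos.ne')
      (fun a _ ↦ div_nonneg (hh ω a) (hs a)) t
    refine le_trans (le_of_eq ?_) (mul_le_mul_of_nonneg_left this (pow_nonneg hpos.le t))
    rw [← mul_pow, mul_sum]
    congr 1
    refine sum_congr rfl fun a _ ↦ ?_
    by_cases ha : s a = 0
    · simp [ha, zero a ha ω]
    · field_simp
  calc ∑ ω, (∑ a, h ω a) ^ t ≤ ∑ ω, T ^ t * ∑ a, s a / T * (h ω a / s a) ^ t :=
        sum_le_sum fun ω _ ↦ jensen ω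
    _ = T ^ t * ∑ a, s a / T * ((∑ ω, h ω a ^ t) / s a ^ t) := by
        rw [← mul_sum, sum_comm]
        simp only [div_pow, ← mul_sum, ← sum_div]
    _ ≤ T ^ t * ∑ a, s a / T * K := by
        refine mul_le_mul_of_nonneg_left (sum_le_sum fun a _ ↦ ?_) (pow_nonneg hpos.le t)
        rcases (hs a).eq_or_lt with ha | ha
        · simp [← ha]
        · refine mul_le_mul_of_nonneg_left ?_ (div_nonneg ha.le hpos.le)
          rw [div_le_iff₀ (pow_pos ha t)]
          exact hK a
    _ = K * T ^ t := by rw [← sum_mul, ← sum_div, div_self hpos.ne']; ring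

/-- The sign of a key under an assignment of signs to position characters. -/
def keySign {c : ℕ} {A : Type*} (ε : Fin c → A → ℤˣ) (x : Fin c → A) : ℝ :=
  ∏ i, ((ε i (x i) : ℤ) : ℝ)

/-- Even moments of a decoupled Rademacher chaos. -/
lemma sum_keySign_pow_le {A : Type*} [Fintype A] [DecidableEq A] {t : ℕ} (ht : t ≠ 0) (c : ℕ)
    (f : (Fin c → A) → ℝ) :
    ∑ ε : Fin c → A → ℤˣ, (∑ x, f x * keySign ε x) ^ (2 * t) ≤
      (Fintype.card (A → ℤˣ) * (Nat.doubleFactorial (2 * t - 1))) ^ c * (∑ x, f x ^ 2) ^ t := by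
  induction c with
  | zero => simp [keySign, pow_mul, univ_unique]
  | succ c ih =>
    have split {B : Type _} [Fintype B] (F : (Fin (c + 1) → B) → ℝ) :
        ∑ x, F x = ∑ x : Fin c → B, ∑ b, F (Fin.cons b x) := by
      rw [← (Fin.consEquiv fun _ ↦ B).sum_comp, Fintype.sum_prod_type, sum_comm]
      rfl
    set D : ℝ := Fintype.card (A → ℤˣ) * (Nat.doubleFactorial (2 * t - 1)) with hD
    have hD0 : 0 ≤ D := by positivity
    let g (ε : Fin c → A → ℤˣ) (a : A) : ℝ := ∑ x : Fin c → A, f (Fin.cons a x) * keySign ε x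
    have chaos (ε : Fin c → A → ℤˣ) (e : A → ℤˣ) :
        ∑ x, f x * keySign (Fin.cons e ε : Fin (c + 1) → A → ℤˣ) x = ∑ a, (e a : ℤ) * g ε a := by
      rw [split, sum_comm]
      refine sum_congr rfl fun a _ ↦ ?_
      rw [mul_sum]
      refine sum_congr rfl fun x _ ↦ ?_
      simp only [keySign, Fin.prod_univ_succ, Fin.cons_zero, Fin.cons_succ]
      ring
    rw [split (B := A → ℤˣ)]
    simp only [chaos]
    calc _ ≤ ∑ ε : Fin c → A → ℤˣ, D * (∑ a, g ε a ^ 2) ^ t :=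
          sum_le_sum fun ε _ ↦ sum_sign_pow_le (g ε) t
      _ = D * ∑ ε : Fin c → A → ℤˣ, (∑ a, g ε a ^ 2) ^ t := by rw [mul_sum]
      _ ≤ D * (D ^ c * (∑ a, ∑ x : Fin c → A, f (Fin.cons a x) ^ 2) ^ t) := by
          gcongr
          refine sum_sum_pow_le ht _ (fun _ _ ↦ sq_nonneg _) _
            (fun _ ↦ sum_nonneg fun _ _ ↦ sq_nonneg _) fun a ↦ ?_
          simpa only [← pow_mul] using ih fun x ↦ f (Fin.cons a x)
      _ = _ := by rw [split, sum_comm, pow_succ']; ring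

/-- Averaging over all sign assignments bounds the number of tuples with a given symmetric
difference. -/
lemma card_filter_oddSupport_le {A : Type*} [Fintype A] [DecidableEq A] (c k : ℕ)
    (S : Finset (Fin c → A)) (p : Finset (Fin c × A)) :
    ((univ.filter fun x : Fin k → (Fin c → A) ↦ (∀ j, x j ∈ S) ∧ oddSupport x = p).card : ℝ) *
        Fintype.card (Fin c → A → ℤˣ) ≤
      ∑ ε : Fin c → A → ℤˣ, (∏ q ∈ p, ((ε q.1 q.2 : ℤ) : ℝ)) * (∑ x ∈ S, keySign ε x) ^ k := by
  let m (x : Fin k → (Fin c → A)) (i : Fin c) (a : A) : ℕ :=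
    (if (i, a) ∈ p then 1 else 0) + (univ.filter fun j ↦ x j i = a).card
  have expand (ε : Fin c → A → ℤˣ) (x : Fin k → (Fin c → A)) :
      (∏ q ∈ p, ((ε q.1 q.2 : ℤ) : ℝ)) * ∏ j, keySign ε (x j) =
        ∏ i, ∏ a, ((ε i a : ℤ) : ℝ) ^ m x i a := by
    simp only [m, pow_add, prod_mul_distrib, keySign]
    congr 1
    · rw [← Fintype.prod_prod_type'
        (f := fun i a ↦ ((ε i a : ℤ) : ℝ) ^ (if (i, a) ∈ p then 1 else 0))]
      simp [pow_ite, prod_ite_mem]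
    · rw [prod_comm]
      refine prod_congr rfl fun i _ ↦ ?_
      rw [← prod_fiberwise' univ (fun j ↦ x j i) fun a ↦ ((ε i a : ℤ) : ℝ)]
      simp
  have nonneg (x : Fin k → (Fin c → A)) :
      0 ≤ ∑ ε : Fin c → A → ℤˣ, ∏ i, ∏ a, ((ε i a : ℤ) : ℝ) ^ m x i a := by
    have h1 := Finset.prod_univ_sum (fun _ : Fin c ↦ (univ : Finset (A → ℤˣ)))
      (fun i e ↦ ∏ a, ((e a : ℤ) : ℝ) ^ m x i a)
    rw [Fintype.piFinset_univ] at h1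
    rw [← h1]
    refine prod_nonneg fun i _ ↦ ?_
    have h2 := Finset.prod_univ_sum (fun _ : A ↦ (univ : Finset ℤˣ))
      (fun a s ↦ ((s : ℤ) : ℝ) ^ m x i a)
    rw [Fintype.piFinset_univ] at h2
    rw [← h2]
    refine prod_nonneg fun a _ ↦ ?_
    rcases Nat.even_or_odd (m x i a) with h | h <;> simp [h.neg_one_pow]
  have full (x : Fin k → (Fin c → A)) (hx : oddSupport x = p) :
      ∑ ε : Fin c → A → ℤˣ, ∏ i, ∏ a, ((ε i a : ℤ) : ℝ) ^ m x i a =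
        Fintype.card (Fin c → A → ℤˣ) := by
    have even (i : Fin c) (a : A) : Even (m x i a) := by
      simp only [m, ← hx, oddSupport, mem_filter, mem_univ, true_and]
      split_ifs with h
      · exact odd_one.add_odd h
      · simpa using h
    have one (s : ℤˣ) (i : Fin c) (a : A) : ((s : ℤ) : ℝ) ^ m x i a = 1 := by
      rcases Int.units_eq_one_or s with rfl | rfl <;> simp [(even i a).neg_one_pow]
    simp [one]
  have hR : ∑ ε : Fin c → A → ℤˣ, (∏ q ∈ p, ((ε q.1 q.2 : ℤ) : ℝ)) * (∑ x ∈ S, keySign ε x) ^ k =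
      ∑ x ∈ Fintype.piFinset fun _ : Fin k ↦ S,
        ∑ ε : Fin c → A → ℤˣ, ∏ i, ∏ a, ((ε i a : ℤ) : ℝ) ^ m x i a := by
    rw [sum_comm]
    refine sum_congr rfl fun ε _ ↦ ?_
    have := Finset.prod_univ_sum (fun _ : Fin k ↦ S) (fun _ x ↦ keySign ε x)
    rw [prod_const, card_univ, Fintype.card_fin] at this
    rw [this, mul_sum]
    exact sum_congr rfl fun x _ ↦ expand ε x
  rw [hR, ← nsmul_eq_mul, ← sum_const]
  refine (sum_le_sum fun x hx ↦ (full x (mem_filter.1 hx).2.2).ge).trans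
    (sum_le_sum_of_subset_of_nonneg (fun x hx ↦ ?_) fun x _ _ ↦ nonneg x)
  exact Fintype.mem_piFinset.2 (mem_filter.1 hx).2.1

/-- The number of `2t`-tuples from `S^{2t}` with symmetric difference `p` is at most
`((2t-1)‼)^c · n^t` where `n = |S|`. -/
theorem stmt7 {Alph : Type*} [Fintype Alph] [DecidableEq Alph] (c t : ℕ) (hc : 1 ≤ c)
    (S : Finset (Fin c → Alph)) (p : Finset (Fin c × Alph)) :
    (Finset.univ.filter (fun x : Fin (2 * t) → (Fin c → Alph) =>
        (∀ k, x k ∈ S) ∧ oddSupport x = p)).card ≤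
      (Nat.doubleFactorial (2 * t - 1)) ^ c * S.card ^ t := by
  rcases eq_or_ne t 0 with rfl | ht
  · simpa using card_le_one_of_subsingleton _
  have hpos : (0 : ℝ) < Fintype.card (Fin c → Alph → ℤˣ) := by positivity
  have sign (ε : Fin c → Alph → ℤˣ) : ∏ q ∈ p, ((ε q.1 q.2 : ℤ) : ℝ) ≤ 1 := by
    refine (le_abs_self _).trans_eq ?_
    rw [abs_prod]
    refine prod_eq_one fun q _ ↦ ?_
    rcases Int.units_eq_one_or (ε q.1 q.2) with h | h <;> simp [h]
  have moment := sum_keySign_pow_le ht c fun x ↦ if x ∈ S then 1 else 0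
  simp only [ite_mul, one_mul, zero_mul, sum_ite_mem, univ_inter, ite_pow, one_pow, ne_eq,
    OfNat.ofNat_ne_zero, not_false_eq_true, zero_pow, sum_const, nsmul_eq_mul, mul_one] at moment
  have bound := (card_filter_oddSupport_le c (2 * t) S p).trans
    ((sum_le_sum fun ε _ ↦ mul_le_of_le_one_left ((even_two_mul t).pow_nonneg _) (sign ε)).trans
      moment)
  have hcard : (Fintype.card (Fin c → Alph → ℤˣ) : ℝ) = (Fintype.card (Alph → ℤˣ) : ℝ) ^ c := by
    rw [Fintype.card_fun, Fintype.card_fin]; push_cast; rfl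
  rw [mul_pow, ← hcard, mul_assoc, mul_comm] at bound
  exact_mod_cast le_of_mul_le_mul_left bound hpos
end
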